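/- arXiv:2004.02159 — 2 statements merged into one kernel-verified Lean document; each statement's English description precedes it below -/
import Mathlib

section
/- Let G be a finite simple graph whose vertex set is partitioned as V(G) = X ⊔ Y such that every vertex of Y has exactly 2 neighbors in X. If the graph polynomial P_{G[X]} has a monomial with nonzero coefficient in which every variable has degree at most 4, and P_{G[Y]} has a monomial with nonzero coefficient in which every variable has degree at most 3, then P_G has a monomial with nonzero coefficient in which every variable has degree at most 5; consequently AT(G) ≤ 6. (This is the algebraic content of the paper's theorem that AT(Ḡ_{ve}) ≤ 6 for every plane graph G, with X the vertex set, Y the edge set, G[X] the plane graph itself whose Alon–Tarsi number is at most 5, G[Y] the 4-regular medial graph whose Alon–Tarsi number is at most 4, and each edge incident to exactly 2 vertices.) -/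
open MvPolynomial Finset

/-- The graph polynomial of `G`: the product, over edges `v_i v_j` of `G` with
`v_i < v_j`, of the factors `(X_i - X_j)`. -/
noncomputable def graphPoly {V : Type*} [Fintype V] [LinearOrder V]
    (G : SimpleGraph V) [DecidableRel G.Adj] : MvPolynomial V ℝ :=
  ∏ p ∈ univ.filter (fun p : V × V => G.Adj p.1 p.2 ∧ p.1 < p.2),
    (X p.1 - X p.2)

/-- The graph polynomial of the induced subgraph `G[s]`, taken in the
corresponding subset of variables (with the inherited vertex ordering). -/
noncomputable def graphPolyOn {V : Type*} [Fintype V] [LinearOrder V]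
    (G : SimpleGraph V) [DecidableRel G.Adj] (s : Finset V) : MvPolynomial V ℝ :=
  ∏ p ∈ univ.filter (fun p : V × V => G.Adj p.1 p.2 ∧ p.1 < p.2 ∧ p.1 ∈ s ∧ p.2 ∈ s),
    (X p.1 - X p.2)

/-- The Alon–Tarsi number of `G`: the least `k` such that `P_G` has a monomial with
nonzero coefficient in which every variable has degree at most `k - 1`. -/
noncomputable def ATNumber {V : Type*} [Fintype V] [LinearOrder V]
    (G : SimpleGraph V) [DecidableRel G.Adj] : ℕ :=
  sInf {k : ℕ | ∃ m : V →₀ ℕ, MvPolynomial.coeff m (graphPoly G) ≠ 0 ∧ ∀ v, m v < k}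

/-- If `m` is a monomial of `P` of maximal weight, then multiplying `P` by differences
`± (X (l i) - X (h i))` with `h i` of larger weight than `l i` keeps the monomial obtained from `m`
by choosing `X (h i)` in each factor, and this monomial again has maximal weight. -/
theorem coeff_mul_prod_X_sub_X_ne_zero {σ ι R : Type*} [CommRing R] (w : σ → ℕ)
    (P : MvPolynomial σ R) (m : σ →₀ ℕ) (hm : coeff m P ≠ 0)
    (hP : ∀ n, coeff n P ≠ 0 → Finsupp.weight w n ≤ Finsupp.weight w m)
    (S : Finset ι) (f : ι → MvPolynomial σ R) (h l : ι → σ)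
    (hf : ∀ i ∈ S, f i = X (l i) - X (h i) ∨ f i = X (h i) - X (l i))
    (hw : ∀ i ∈ S, w (l i) < w (h i)) :
    coeff (m + ∑ i ∈ S, Finsupp.single (h i) 1) (P * ∏ i ∈ S, f i) ≠ 0 ∧
      ∀ n, coeff n (P * ∏ i ∈ S, f i) ≠ 0 →
        Finsupp.weight w n ≤ Finsupp.weight w (m + ∑ i ∈ S, Finsupp.single (h i) 1) := by
  classical
  induction S using Finset.induction_on with
  | empty => simpa using ⟨hm, hP⟩
  | insert a S ha ih =>
    obtain ⟨ih1, ih2⟩ := ih (fun i hi => hf i (mem_insert_of_mem hi))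
      (fun i hi => hw i (mem_insert_of_mem hi))
    have hfa := hf a (mem_insert_self a S)
    have hwa := hw a (mem_insert_self a S)
    rw [prod_insert ha, sum_insert ha, mul_left_comm, mul_comm (f a),
      add_left_comm, add_comm (Finsupp.single (h a) 1)]
    generalize P * ∏ i ∈ S, f i = Q at *
    generalize m + ∑ i ∈ S, Finsupp.single (h i) 1 = k at *
    have hX : ∀ s n, coeff n (Q * X s) ≠ 0 →
        Finsupp.weight w n ≤ Finsupp.weight w k + w s := by
      intro s n hn
      rw [coeff_mul_X'] at hn
      split_ifs at hn with hs
      · have hle : Finsupp.single s 1 ≤ n := by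
          rw [Finsupp.single_le_iff]
          exact Nat.one_le_iff_ne_zero.2 (Finsupp.mem_support_iff.1 hs)
        rw [← tsub_add_cancel_of_le hle, map_add, Finsupp.weight_single, one_smul]
        exact Nat.add_le_add_right (ih2 _ hn) _
      · exact absurd rfl hn
    have hwk : Finsupp.weight w (k + Finsupp.single (h a) 1) = Finsupp.weight w k + w (h a) := by
      rw [map_add, Finsupp.weight_single, one_smul]
    have hl : coeff (k + Finsupp.single (h a) 1) (Q * X (l a)) = 0 := by
      by_contra hne
      have := hX _ _ hne
      omega
    have hb : ∀ n, coeff n (Q * X (h a)) ≠ 0 ∨ coeff n (Q * X (l a)) ≠ 0 →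
        Finsupp.weight w n ≤ Finsupp.weight w (k + Finsupp.single (h a) 1) := by
      rintro n (hn | hn) <;> have := hX _ _ hn <;> omega
    rcases hfa with hfa | hfa <;> rw [hfa, mul_sub] <;> simp only [coeff_sub, hl, coeff_mul_X]
    · refine ⟨by simpa using ih1, fun n hn => hb n ?_⟩
      by_contra! hc
      simp [hc] at hn
    · refine ⟨by simpa using ih1, fun n hn => hb n ?_⟩
      by_contra! hc
      simp [hc] at hn

/-- A monomial of a polynomial in the variables of `s` vanishes outside `s`. -/
theorem eq_zero_of_coeff_ne_zero_of_mem_supported {σ R : Type*} [CommSemiring R] {s : Set σ}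
    {P : MvPolynomial σ R} (hP : P ∈ supported R s) {m : σ →₀ ℕ} (hm : coeff m P ≠ 0)
    {v : σ} (hv : v ∉ s) : m v = 0 := by
  by_contra hne
  exact hv (mem_supported.1 hP ((mem_vars_iff_mem_support v).2
    ⟨m, mem_support_iff.2 hm, Finsupp.mem_support_iff.2 hne⟩))

/-- Coefficients of a product of polynomials in disjoint sets of variables multiply. -/
theorem coeff_add_mul_of_mem_supported {σ R : Type*} [CommSemiring R] {s t : Set σ}
    (hst : Disjoint s t) {P Q : MvPolynomial σ R} (hP : P ∈ supported R s)
    (hQ : Q ∈ supported R t) {m n : σ →₀ ℕ} (hm : coeff m P ≠ 0) (hn : coeff n Q ≠ 0) :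
    coeff (m + n) (P * Q) = coeff m P * coeff n Q := by
  classical
  rw [coeff_mul]
  refine sum_eq_single (m, n) ?_ (by simp)
  rintro ⟨a, b⟩ hab hne
  by_contra h0
  have ha : coeff a P ≠ 0 := left_ne_zero_of_mul h0
  have hb : coeff b Q ≠ 0 := right_ne_zero_of_mul h0
  have key : ∀ v, a v = m v ∧ b v = n v := by
    intro v
    have hv : a v + b v = m v + n v := DFunLike.congr_fun (mem_antidiagonal.1 hab) v
    by_cases hs : v ∈ s
    · have ht : v ∉ t := Set.disjoint_left.1 hst hs
      have := eq_zero_of_coeff_ne_zero_of_mem_supported hQ hb ht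
      have := eq_zero_of_coeff_ne_zero_of_mem_supported hQ hn ht
      omega
    · have := eq_zero_of_coeff_ne_zero_of_mem_supported hP ha hs
      have := eq_zero_of_coeff_ne_zero_of_mem_supported hP hm hs
      omega
  exact hne (Prod.ext (Finsupp.ext fun v => (key v).1) (Finsupp.ext fun v => (key v).2))

theorem graphPolyOn_mem_supported {V : Type*} [Fintype V] [LinearOrder V]
    (G : SimpleGraph V) [DecidableRel G.Adj] (s : Finset V) :
    graphPolyOn G s ∈ supported ℝ (s : Set V) := by
  refine Subalgebra.prod_mem _ fun p hp => ?_
  simp only [mem_filter] at hp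
  exact Subalgebra.sub_mem _ (X_mem_supported.2 hp.2.2.2.1) (X_mem_supported.2 hp.2.2.2.2)

/-- If all vertices of `s` have weight `c`, then `graphPolyOn G s` is weighted homogeneous. -/
theorem isWeightedHomogeneous_graphPolyOn {V : Type*} [Fintype V] [LinearOrder V]
    (G : SimpleGraph V) [DecidableRel G.Adj] (s : Finset V) (w : V → ℕ) (c : ℕ)
    (hw : ∀ v ∈ s, w v = c) : ∃ d, IsWeightedHomogeneous w (graphPolyOn G s) d := by
  refine ⟨_, IsWeightedHomogeneous.prod _ _ (fun _ => c) fun p hp => ?_⟩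
  simp only [mem_filter] at hp
  have h1 := isWeightedHomogeneous_X ℝ w p.1
  have h2 := isWeightedHomogeneous_X ℝ w p.2
  rw [hw _ hp.2.2.2.1] at h1
  rw [hw _ hp.2.2.2.2] at h2
  exact (weightedHomogeneousSubmodule ℝ w c).sub_mem h1 h2

/-- The edges `p` of `G`, listed with `p.1 < p.2`, that have exactly one end in `B`. -/
def cutEdges {V : Type*} [Fintype V] [LinearOrder V]
    (G : SimpleGraph V) [DecidableRel G.Adj] (B : Finset V) : Finset (V × V) :=
  univ.filter fun p : V × V => G.Adj p.1 p.2 ∧ p.1 < p.2 ∧ ¬(p.1 ∈ B ↔ p.2 ∈ B)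

/-- The graph polynomial splits according to a vertex set and its complement. -/
theorem graphPoly_eq_mul_prod_cutEdges {V : Type*} [Fintype V] [LinearOrder V]
    (G : SimpleGraph V) [DecidableRel G.Adj] (B : Finset V) :
    graphPoly G = graphPolyOn G Bᶜ * graphPolyOn G B * ∏ p ∈ cutEdges G B, (X p.1 - X p.2) := by
  unfold graphPoly graphPolyOn cutEdges
  rw [← prod_union, ← prod_union]
  · refine prod_congr ?_ fun _ _ => rfl
    ext p
    simp only [mem_filter, mem_union, mem_univ, mem_compl, true_and]
    tauto
  · rw [disjoint_left]
    intro p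
    simp only [mem_filter, mem_union, mem_univ, mem_compl, true_and]
    tauto
  · rw [disjoint_left]
    intro p
    simp only [mem_filter, mem_univ, mem_compl, true_and]
    tauto

/-- The edges of the cut that meet `B` in `v` inject into the neighbors of `v` outside `B`. -/
theorem card_filter_cutEdges_le {V : Type*} [Fintype V] [LinearOrder V]
    (G : SimpleGraph V) [DecidableRel G.Adj] (B : Finset V) (v : V) :
    ((cutEdges G B).filter fun p => (if p.1 ∈ B then p.1 else p.2) = v).card ≤
      (Bᶜ.filter fun x => G.Adj v x).card := by
  refine card_le_card_of_injOn (fun p => if p.1 ∈ B then p.2 else p.1) ?_ ?_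
  · rintro ⟨a, b⟩ hp
    simp only [cutEdges, coe_filter, mem_filter, mem_univ, true_and, Set.mem_ofPred_eq,
      mem_compl] at hp ⊢
    obtain ⟨⟨hadj, -, hB⟩, rfl⟩ := hp
    split_ifs with ha
    · exact ⟨by tauto, hadj⟩
    · exact ⟨ha, hadj.symm⟩
  · rintro ⟨a, b⟩ hp ⟨c, d⟩ hq hpq
    simp only [cutEdges, coe_filter, mem_filter, mem_univ, true_and, Set.mem_ofPred_eq] at hp hq hpq
    obtain ⟨⟨-, hab, -⟩, h1⟩ := hp
    obtain ⟨⟨-, hcd, -⟩, h2⟩ := hq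
    rw [Prod.mk.injEq]
    split_ifs at h1 h2 hpq <;> subst h1 <;> subst hpq <;> subst h2 <;>
      first | exact ⟨rfl, rfl⟩ | exact absurd hab hcd.asymm

/-- Algebraic content of \`AT(Ḡ_{ve}) ≤ 6\`: if \`V(G) = A ⊔ B\` with every vertex of \`B\` having exactly 2 neighbors in \`A\`, \`P_{G[A]}\` has a non-vanishing monomial with all degrees at most 4, and \`P_{G[B]}\` has a non-vanishing monomial with all degrees at most 3, then \`P_G\` has a non-vanishing monomial with all degrees at most 5; consequently \`AT(G) ≤ 6\`. -/
theorem atNumber_le_six_facial_total {V : Type*} [Fintype V] [LinearOrder V]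
    (G : SimpleGraph V) [DecidableRel G.Adj]
    (A B : Finset V) (hcover : A ∪ B = univ) (hdisj : Disjoint A B)
    (ht : ∀ y ∈ B, (A.filter (fun x => G.Adj y x)).card = 2)
    (hA : ∃ m : V →₀ ℕ, MvPolynomial.coeff m (graphPolyOn G A) ≠ 0 ∧ ∀ v, m v ≤ 4)
    (hB : ∃ m : V →₀ ℕ, MvPolynomial.coeff m (graphPolyOn G B) ≠ 0 ∧ ∀ v, m v ≤ 3) :
    (∃ m : V →₀ ℕ, MvPolynomial.coeff m (graphPoly G) ≠ 0 ∧ ∀ v, m v ≤ 5) ∧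
    ATNumber G ≤ 6 := by
  have hAB : A = Bᶜ := by
    ext v
    rw [mem_compl]
    exact ⟨fun hA => disjoint_left.1 hdisj hA, fun hB =>
      (mem_union.1 (hcover ▸ mem_univ v)).resolve_right hB⟩
  subst hAB
  obtain ⟨a, ha, ha4⟩ := hA
  obtain ⟨b, hb, hb3⟩ := hB
  set w : V → ℕ := fun v => if v ∈ B then 1 else 0 with hw
  have hsA := graphPolyOn_mem_supported G Bᶜ
  have hsB := graphPolyOn_mem_supported G B
  have hab : coeff (a + b) (graphPolyOn G Bᶜ * graphPolyOn G B) ≠ 0 := by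
    rw [coeff_add_mul_of_mem_supported (disjoint_coe.2 hdisj) hsA hsB ha hb]
    exact mul_ne_zero ha hb
  obtain ⟨c, hc⟩ := isWeightedHomogeneous_graphPolyOn G Bᶜ w 0
    (fun v hv => if_neg (mem_compl.1 hv))
  obtain ⟨d, hd⟩ := isWeightedHomogeneous_graphPolyOn G B w 1 (fun v hv => if_pos hv)
  have hcd := hc.mul hd
  set h : V × V → V := fun p => if p.1 ∈ B then p.1 else p.2 with hh
  obtain ⟨hne, -⟩ := coeff_mul_prod_X_sub_X_ne_zero w _ (a + b) hab
    (fun n hn => (hcd hn).trans_le (hcd hab).ge) (cutEdges G B) (fun p => X p.1 - X p.2) h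
    (fun p => if p.1 ∈ B then p.2 else p.1)
    (fun p _ => by by_cases hp : p.1 ∈ B <;> simp [hh, hp])
    (fun p hp => by
      simp only [cutEdges, mem_filter] at hp
      by_cases h1 : p.1 ∈ B <;> by_cases h2 : p.2 ∈ B <;> simp_all)
  rw [← graphPoly_eq_mul_prod_cutEdges] at hne
  have hle : ∀ v, (a + b + ∑ p ∈ cutEdges G B, Finsupp.single (h p) 1 : V →₀ ℕ) v ≤ 5 := by
    intro v
    have hsum : (∑ p ∈ cutEdges G B, Finsupp.single (h p) 1 : V →₀ ℕ) v =
        ((cutEdges G B).filter fun p => h p = v).card := by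
      simp [Finsupp.finsetSum_apply, Finsupp.single_apply]
    rw [Finsupp.add_apply, Finsupp.add_apply, hsum]
    by_cases hv : v ∈ B
    · have h0 : a v = 0 := eq_zero_of_coeff_ne_zero_of_mem_supported hsA ha (by simpa using hv)
      have h2 : ((cutEdges G B).filter fun p => h p = v).card ≤ 2 :=
        (card_filter_cutEdges_le G B v).trans_eq (ht v hv)
      have h3 := hb3 v
      omega
    · have h0 : b v = 0 := eq_zero_of_coeff_ne_zero_of_mem_supported hsB hb (by simpa using hv)
      have h2 : ((cutEdges G B).filter fun p => h p = v) = ∅ := by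
        refine filter_eq_empty_iff.2 fun p hp hpv => hv ?_
        simp only [cutEdges, mem_filter] at hp
        rw [← hpv]
        by_cases h1 : p.1 ∈ B <;> simp_all
      have h3 := ha4 v
      rw [h2, card_empty]
      omega
  exact ⟨⟨_, hne, hle⟩, Nat.sInf_le ⟨_, hne, fun v => Nat.lt_succ_of_le (hle v)⟩⟩
end

section
/- Let G be a finite simple graph whose vertex set is partitioned as V(G) = X ⊔ Y such that every vertex of Y has exactly 4 neighbors in X. If the graph polynomial P_{G[X]} has a monomial with nonzero coefficient in which every variable has degree at most 5, and P_{G[Y]} has a monomial with nonzero coefficient in which every variable has degree at most 2, then P_G has a monomial with nonzero coefficient in which every variable has degree at most 6; consequently AT(G) ≤ 7. (This is the algebraic content of the paper's theorem that AT(Ḡ_{vef}) ≤ 7 for every plane triangulation G, with X the union of vertices and faces, Y the edge set, each edge incident to exactly 2 vertices and 2 faces.) -/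
open MvPolynomial Finset

section

variable {V : Type*} [Fintype V] [LinearOrder V] (G : SimpleGraph V) [DecidableRel G.Adj]

/-- The edges of `G` (as increasing pairs) that lie neither inside `A` nor inside `B`. -/
def crossPairs (A B : Finset V) : Finset (V × V) :=
  univ.filter fun p => G.Adj p.1 p.2 ∧ p.1 < p.2 ∧ ¬(p.1 ∈ A ∧ p.2 ∈ A) ∧ ¬(p.1 ∈ B ∧ p.2 ∈ B)

lemma graphPoly_eq_mul_crossPairs {A B : Finset V} (hdisj : Disjoint A B) :
    graphPoly G = graphPolyOn G A *
      (graphPolyOn G B * ∏ p ∈ crossPairs G A B, (X p.1 - X p.2)) := by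
  unfold graphPoly graphPolyOn crossPairs
  simp_rw [prod_filter, ← prod_mul_distrib]
  refine prod_congr rfl fun p _ => ?_
  have h : p.1 ∈ A → p.1 ∉ B := fun h => disjoint_left.mp hdisj h
  by_cases h1 : G.Adj p.1 p.2 <;> by_cases h2 : p.1 < p.2 <;> by_cases h3 : p.1 ∈ A <;>
    by_cases h4 : p.2 ∈ A <;> by_cases h5 : p.1 ∈ B <;> by_cases h6 : p.2 ∈ B <;>
    simp_all

lemma isHomogeneous_graphPolyOn (s : Finset V) :
    ∃ n, (graphPolyOn G s).IsHomogeneous n :=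
  ⟨_, IsHomogeneous.prod _ _ (fun _ => 1) fun p _ =>
    (isHomogeneous_X ℝ p.1).sub (isHomogeneous_X ℝ p.2)⟩

lemma vars_graphPolyOn_subset (s : Finset V) : (graphPolyOn G s).vars ⊆ s := by
  refine (vars_prod _).trans (biUnion_subset.mpr fun p hp => ?_)
  obtain ⟨-, -, h1, h2⟩ := (mem_filter.mp hp).2
  refine (vars_sub_subset (X p.1) (q := X p.2)).trans ?_
  simp [insert_subset_iff, vars_X, h1, h2]

variable {G}

lemma eq_zero_of_coeff_graphPolyOn_ne_zero {s : Finset V} {m : V →₀ ℕ}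
    (hm : coeff m (graphPolyOn G s) ≠ 0) {v : V} (hv : v ∉ s) : m v = 0 := by
  by_contra h
  exact hv (vars_graphPolyOn_subset G s
    ((mem_vars_iff_mem_support v).mpr ⟨m, mem_support_iff.mpr hm, Finsupp.mem_support_iff.mpr h⟩))

end

section

variable {σ R : Type*} [DecidableEq σ] [CommRing R]

/-- Setting the variables in `A` to zero. -/
noncomputable def killVars (A : Finset σ) : MvPolynomial σ R →ₐ[R] MvPolynomial σ R :=
  aeval fun v => if v ∈ A then 0 else X v

lemma killVars_X (A : Finset σ) (v : σ) :
    killVars A (X v : MvPolynomial σ R) = if v ∈ A then 0 else X v := by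
  simp [killVars]

lemma coeff_killVars {A : Finset σ} {m : σ →₀ ℕ} (hm : ∀ v ∈ A, m v = 0)
    (p : MvPolynomial σ R) : coeff m (killVars A p) = coeff m p := by
  induction p using MvPolynomial.induction_on' with
  | add p q hp hq => simp [hp, hq]
  | monomial u c =>
    by_cases h : ∀ v ∈ A, u v = 0
    · have : killVars A (monomial u c) = monomial u c := by
        rw [killVars, aeval_monomial, monomial_eq, algebraMap_eq]
        congr 1
        refine prod_congr rfl fun v hv => ?_
        have : v ∉ A := fun hA => Finsupp.mem_support_iff.mp hv (h v hA)
        simp [this]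
      rw [this]
    · push Not at h
      obtain ⟨v, hA, hv⟩ := h
      have : killVars A (monomial u c) = 0 := by
        rw [killVars, aeval_monomial, Finsupp.prod,
          prod_eq_zero (Finsupp.mem_support_iff.mpr hv) (by simp [hA, hv]), mul_zero]
      rw [this, coeff_zero, coeff_monomial, if_neg]
      rintro rfl
      exact hv (hm v hA)

end

section

variable {V : Type*} [Fintype V] [LinearOrder V] {G : SimpleGraph V} [DecidableRel G.Adj]

lemma killVars_graphPolyOn {A B : Finset V} (hdisj : Disjoint A B) :
    killVars A (graphPolyOn G B) = graphPolyOn G B := by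
  unfold graphPolyOn
  rw [map_prod]
  refine prod_congr rfl fun p hp => ?_
  obtain ⟨-, -, h1, h2⟩ := (mem_filter.mp hp).2
  rw [map_sub, killVars_X, killVars_X, if_neg (disjoint_right.mp hdisj h1),
    if_neg (disjoint_right.mp hdisj h2)]

lemma mem_crossPairs {A B : Finset V} (hcover : A ∪ B = univ) (hdisj : Disjoint A B)
    {p : V × V} (hp : p ∈ crossPairs G A B) : G.Adj p.1 p.2 ∧ p.1 < p.2 ∧
      (p.1 ∈ A ∧ p.2 ∈ B ∧ p.2 ∉ A ∨ p.1 ∈ B ∧ p.1 ∉ A ∧ p.2 ∈ A) := by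
  obtain ⟨hadj, hlt, h1, h2⟩ := (mem_filter.mp hp).2
  have hc (v : V) : v ∈ A ∨ v ∈ B := mem_union.mp (hcover ▸ mem_univ v)
  have hd (v : V) : v ∈ A → v ∉ B := fun h => disjoint_left.mp hdisj h
  have := hc p.1
  have := hc p.2
  have := hd p.1
  have := hd p.2
  refine ⟨hadj, hlt, ?_⟩
  tauto

/-- The exponent of the monomial obtained from the cross edges by always choosing the
endpoint outside `A`. -/
noncomputable def crossExponent (G : SimpleGraph V) [DecidableRel G.Adj]
    (A B : Finset V) : V →₀ ℕ :=
  ∑ p ∈ crossPairs G A B, Finsupp.single (if p.1 ∈ A then p.2 else p.1) 1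

lemma crossExponent_apply (A B : Finset V) (y : V) : crossExponent G A B y =
    ((crossPairs G A B).filter fun p => (if p.1 ∈ A then p.2 else p.1) = y).card := by
  simp only [crossExponent, Finsupp.finsetSum_apply, Finsupp.single_apply, card_filter]

lemma killVars_prod_crossPairs {A B : Finset V} (hcover : A ∪ B = univ) (hdisj : Disjoint A B) :
    ∃ ε : ℝ, ε ≠ 0 ∧ killVars A (∏ p ∈ crossPairs G A B, (X p.1 - X p.2)) =
      monomial (crossExponent G A B) ε := by
  refine ⟨∏ p ∈ crossPairs G A B, (if p.1 ∈ A then -1 else 1),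
    prod_ne_zero_iff.mpr fun p _ => by split_ifs <;> norm_num, ?_⟩
  rw [crossExponent, monomial_sum_index, map_prod, map_prod, ← prod_mul_distrib]
  refine prod_congr rfl fun p hp => ?_
  rcases (mem_crossPairs hcover hdisj hp).2.2 with ⟨h1, -, h2⟩ | ⟨-, h1, h2⟩ <;>
    simp [killVars_X, h1, h2, ← X.eq_def]

lemma crossExponent_eq_zero {A B : Finset V} (hcover : A ∪ B = univ) (hdisj : Disjoint A B)
    {x : V} (hx : x ∈ A) : crossExponent G A B x = 0 := by
  rw [crossExponent_apply, card_eq_zero, filter_eq_empty_iff]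
  rintro p hp rfl
  rcases (mem_crossPairs hcover hdisj hp).2.2 with ⟨h1, -, h2⟩ | ⟨-, h1, h2⟩ <;> simp_all

lemma crossExponent_le {A B : Finset V} (hcover : A ∪ B = univ) (hdisj : Disjoint A B) (y : V) :
    crossExponent G A B y ≤ (A.filter fun x => G.Adj y x).card := by
  rw [crossExponent_apply]
  refine card_le_card_of_injOn (fun p => if p.1 ∈ A then p.1 else p.2) ?_ ?_
  · intro p hp
    obtain ⟨hpc, rfl⟩ := mem_filter.mp hp
    obtain ⟨hadj, -, ⟨h1, -, h2⟩ | ⟨-, h1, h2⟩⟩ := mem_crossPairs hcover hdisj hpc <;>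
      simp [h1, h2, hadj, hadj.symm]
  · intro p hp q hq hpq
    obtain ⟨hpc, hpy⟩ := mem_filter.mp hp
    obtain ⟨hqc, hqy⟩ := mem_filter.mp hq
    obtain ⟨-, hp', -⟩ := mem_crossPairs hcover hdisj hpc
    obtain ⟨-, hq', -⟩ := mem_crossPairs hcover hdisj hqc
    rw [← hqy] at hpy
    dsimp only at hpq
    split_ifs at hpq hpy
    · exact Prod.ext hpq hpy
    · exact absurd (hpq ▸ hpy ▸ hp') hq'.asymm
    · exact absurd (hpq ▸ hpy ▸ hp') hq'.asymm
    · exact Prod.ext hpy hpq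

/-- Merging nonvanishing monomials of `P_{G[A]}` and `P_{G[B]}`: since `P_{G[A]}` is homogeneous,
the only contribution of the cross edges to this coefficient takes the `B`-endpoint everywhere. -/
lemma coeff_graphPoly_add_ne_zero {A B : Finset V} (hcover : A ∪ B = univ)
    (hdisj : Disjoint A B) {a b : V →₀ ℕ} (ha : coeff a (graphPolyOn G A) ≠ 0)
    (hb : coeff b (graphPolyOn G B) ≠ 0) :
    coeff (a + (b + crossExponent G A B)) (graphPoly G) ≠ 0 := by
  have hzero : ∀ v ∈ A, (b + crossExponent G A B) v = 0 := fun v hv => by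
    rw [Finsupp.add_apply, crossExponent_eq_zero hcover hdisj hv,
      eq_zero_of_coeff_graphPolyOn_ne_zero hb (disjoint_left.mp hdisj hv)]
  obtain ⟨n, hn⟩ := isHomogeneous_graphPolyOn G A
  obtain ⟨ε, hε, hcross⟩ := killVars_prod_crossPairs (G := G) hcover hdisj
  rw [graphPoly_eq_mul_crossPairs G hdisj, coeff_mul,
    sum_eq_single (a, b + crossExponent G A B)]
  · rw [← coeff_killVars hzero, map_mul, killVars_graphPolyOn hdisj, hcross, coeff_mul_monomial]
    exact mul_ne_zero ha (mul_ne_zero hb hε)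
  · rintro ⟨u, w⟩ huw hne
    rw [HasAntidiagonal.mem_antidiagonal] at huw
    dsimp only at huw ⊢
    by_contra hcoeff
    have hu := left_ne_zero_of_mul hcoeff
    have hle : u ≤ a := fun v => by
      by_cases hv : v ∈ A
      · have h := DFunLike.congr_fun huw v
        have h0 := hzero v hv
        simp only [Finsupp.add_apply] at h h0
        omega
      · simp [eq_zero_of_coeff_graphPolyOn_ne_zero hu hv]
    have hdeg : u.degree = a.degree := by
      rw [Finsupp.degree_eq_weight_one]
      exact (hn hu).trans (hn ha).symm
    have hua : u = a := by
      obtain ⟨c, rfl⟩ := exists_add_of_le hle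
      rw [map_add, left_eq_add, Finsupp.degree_eq_zero_iff] at hdeg
      rw [hdeg, add_zero]
    subst hua
    exact hne (Prod.ext rfl (add_left_cancel huw))
  · simp

end


/-- Algebraic content of \`AT(Ḡ_{vef}) ≤ 7\` for plane triangulations: if \`V(G) = A ⊔ B\` with every vertex of \`B\` having exactly 4 neighbors in \`A\`, \`P_{G[A]}\` has a non-vanishing monomial with all degrees at most 5, and \`P_{G[B]}\` has a non-vanishing monomial with all degrees at most 2, then \`P_G\` has a non-vanishing monomial with all degrees at most 6; consequently \`AT(G) ≤ 7\`. -/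
theorem atNumber_le_seven_facial_entire {V : Type*} [Fintype V] [LinearOrder V]
    (G : SimpleGraph V) [DecidableRel G.Adj]
    (A B : Finset V) (hcover : A ∪ B = univ) (hdisj : Disjoint A B)
    (ht : ∀ y ∈ B, (A.filter (fun x => G.Adj y x)).card = 4)
    (hA : ∃ m : V →₀ ℕ, MvPolynomial.coeff m (graphPolyOn G A) ≠ 0 ∧ ∀ v, m v ≤ 5)
    (hB : ∃ m : V →₀ ℕ, MvPolynomial.coeff m (graphPolyOn G B) ≠ 0 ∧ ∀ v, m v ≤ 2) :
    (∃ m : V →₀ ℕ, MvPolynomial.coeff m (graphPoly G) ≠ 0 ∧ ∀ v, m v ≤ 6) ∧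
    ATNumber G ≤ 7 := by
  obtain ⟨a, ha, ha5⟩ := hA
  obtain ⟨b, hb, hb2⟩ := hB
  have key : ∃ m : V →₀ ℕ, MvPolynomial.coeff m (graphPoly G) ≠ 0 ∧ ∀ v, m v ≤ 6 := by
    refine ⟨_, coeff_graphPoly_add_ne_zero hcover hdisj ha hb, fun v => ?_⟩
    simp only [Finsupp.add_apply]
    by_cases hv : v ∈ A
    · rw [crossExponent_eq_zero hcover hdisj hv,
        eq_zero_of_coeff_graphPolyOn_ne_zero hb (disjoint_left.mp hdisj hv)]
      exact (ha5 v).trans (by norm_num)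
    · have hvB : v ∈ B := (mem_union.mp (hcover ▸ mem_univ v)).resolve_left hv
      have hcross := crossExponent_le (G := G) hcover hdisj v
      rw [ht v hvB] at hcross
      rw [eq_zero_of_coeff_graphPolyOn_ne_zero ha hv]
      have := hb2 v
      omega
  refine ⟨key, ?_⟩
  obtain ⟨m, hm, hm6⟩ := key
  exact Nat.sInf_le ⟨m, hm, fun v => Nat.lt_succ_of_le (hm6 v)⟩
end
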